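/- Let n ≥ 1, m ≥ 0, l ≥ 1. Let C_1^0,…,C_m^0, U^0, V^0, W^0 : N_0 → M_n(ℂ) be holomorphic maps on an open neighborhood N_0 of 0 in ℂ^m satisfying, for all i,j: [C_i^0,C_j^0]=0, ∂C_i^0/∂t_j = ∂C_j^0/∂t_i, [C_i^0,U^0]=0, ∂U^0/∂t_i = [V^0,C_i^0] − C_i^0, ∂W^0/∂t_i = [W^0,C_i^0], ∂V^0/∂t_i = −[W^0,C_i^0], and assume the generation condition holds for C_1^0(0),…,C_m^0(0), U^0(0) with ζ = e_1 (first standard basis vector). Let f_1,…,f_n be holomorphic near 0 in ℂ^m × ℂ^l with f_i(t,0)=0. Suppose (C_1,…,C_m,F_1,…,F_l,U,V,W) and (C_1',…,C_m',F_1',…,F_l',U',V',W') are two tuples of holomorphic M_n(ℂ)-valued maps, defined on open neighborhoods of 0 in ℂ^m × ℂ^l, which both satisfy: (i) at y=0 they restrict to C_i^0, U^0, V^0, W^0; (ii) the first column of F_α (respectively F_α') equals ((∂f_1/∂y_α),…,(∂f_n/∂y_α))^T; (iii) the full system [C_i,C_j]=0, [C_i,F_α]=0, [F_α,F_β]=0,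 ∂C_i/∂t_j=∂C_j/∂t_i, ∂C_i/∂y_α=∂F_α/∂t_i, ∂F_α/∂y_β=∂F_β/∂y_α, [C_i,U]=0, [F_α,U]=0, ∂U/∂t_i=[V,C_i]−C_i, ∂U/∂y_α=[V,F_α]−F_α, ∂W/∂t_i=[W,C_i], ∂W/∂y_α=[W,F_α], ∂V/∂t_i=−[W,C_i], ∂V/∂y_α=−[W,F_α]. Then the two tuples agree on a common open neighborhood of 0 in ℂ^m × ℂ^l. -/

import Mathlib

/-!
Statement 1 (Lemma 2.9, uniqueness part): two solutions of the unfolding system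
with the same restriction at `y = 0` and the same first columns of the `F_α`
agree near `0`.
-/

noncomputable section

/-- `n × n` complex matrices. -/
abbrev Mat (n : ℕ) := Matrix (Fin n) (Fin n) ℂ

/-- The commutator `[A,B] = A*B - B*A`. -/
def matComm {n : ℕ} (A B : Mat n) : Mat n := A * B - B * A

/-- Entrywise holomorphy of a matrix-valued map on a set. -/
def MDiffOn {E : Type*} [NormedAddCommGroup E] [NormedSpace ℂ E] {n : ℕ}
    (f : E → Mat n) (s : Set E) : Prop :=
  ∀ k j, DifferentiableOn ℂ (fun q => f q k j) s

/-- Entrywise partial derivative of a matrix-valued map at `p` in direction `v`. -/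
def mpderiv {E : Type*} [NormedAddCommGroup E] [NormedSpace ℂ E] {n : ℕ}
    (f : E → Mat n) (p v : E) : Mat n :=
  Matrix.of fun k j => fderiv ℂ (fun q => f q k j) p v

/-- Generation condition: `ζ` together with all vectors obtained from `ζ` by finitely
many successive applications of the matrices `B i` spans `ℂ^n`. -/
def GenCond {n r : ℕ} (B : Fin r → Mat n) (ζ : Fin n → ℂ) : Prop :=
  Submodule.span ℂ
    {v : Fin n → ℂ | ∃ L : List (Fin r), v = Matrix.mulVec (L.map B).prod ζ} = ⊤

/-- Points of `ℂ^m × ℂ^l` with coordinates `(t, y)`. -/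
abbrev Pt (m l : ℕ) := (Fin m → ℂ) × (Fin l → ℂ)

/-- The full flatness system (2.16)–(2.29) at a point `p`. -/
def FullSystemAt {n m l : ℕ}
    (C : Fin m → Pt m l → Mat n) (F : Fin l → Pt m l → Mat n)
    (U V W : Pt m l → Mat n) (p : Pt m l) : Prop :=
  (∀ i j, matComm (C i p) (C j p) = 0) ∧
  (∀ i α, matComm (C i p) (F α p) = 0) ∧
  (∀ α β, matComm (F α p) (F β p) = 0) ∧
  (∀ i j, mpderiv (C i) p (Pi.single j 1, 0) = mpderiv (C j) p (Pi.single i 1, 0)) ∧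
  (∀ i α, mpderiv (C i) p (0, Pi.single α 1) = mpderiv (F α) p (Pi.single i 1, 0)) ∧
  (∀ α β, mpderiv (F α) p (0, Pi.single β 1) = mpderiv (F β) p (0, Pi.single α 1)) ∧
  (∀ i, matComm (C i p) (U p) = 0) ∧
  (∀ α, matComm (F α p) (U p) = 0) ∧
  (∀ i, mpderiv U p (Pi.single i 1, 0) = matComm (V p) (C i p) - C i p) ∧
  (∀ α, mpderiv U p (0, Pi.single α 1) = matComm (V p) (F α p) - F α p) ∧
  (∀ i, mpderiv W p (Pi.single i 1, 0) = matComm (W p) (C i p)) ∧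
  (∀ α, mpderiv W p (0, Pi.single α 1) = matComm (W p) (F α p)) ∧
  (∀ i, mpderiv V p (Pi.single i 1, 0) = - matComm (W p) (C i p)) ∧
  (∀ α, mpderiv V p (0, Pi.single α 1) = - matComm (W p) (F α p))

/-- A solution of the unfolding system on `N`, with prescribed restriction at `y = 0`
and prescribed first columns of the `F_α`. -/
def IsSolution {n m l : ℕ} (hn : 0 < n)
    (C₀ : Fin m → (Fin m → ℂ) → Mat n) (U₀ V₀ W₀ : (Fin m → ℂ) → Mat n)
    (f : Fin n → Pt m l → ℂ) (N : Set (Pt m l))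
    (C : Fin m → Pt m l → Mat n) (F : Fin l → Pt m l → Mat n)
    (U V W : Pt m l → Mat n) : Prop :=
  (∀ i, MDiffOn (C i) N) ∧ (∀ α, MDiffOn (F α) N) ∧
  MDiffOn U N ∧ MDiffOn V N ∧ MDiffOn W N ∧
  -- (i) restriction to y = 0
  (∀ t : Fin m → ℂ, ((t, 0) : Pt m l) ∈ N →
    (∀ i, C i (t, 0) = C₀ i t) ∧ U (t, 0) = U₀ t ∧
      V (t, 0) = V₀ t ∧ W (t, 0) = W₀ t) ∧
  -- (ii) the first column of F_α consists of the ∂f_i/∂y_α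
  (∀ p ∈ N, ∀ α i,
    F α p i (⟨0, hn⟩ : Fin n) =
      fderiv ℂ (f i) p ((0 : Fin m → ℂ), Pi.single α 1)) ∧
  -- (iii) the full flatness system
  (∀ p ∈ N, FullSystemAt C F U V W p)

open Filter Topology Asymptotics

section VanishingAlongASubspace

variable {T Y A : Type*} [NormedAddCommGroup T] [NormedSpace ℂ T]
  [NormedAddCommGroup Y] [NormedSpace ℂ Y] [NormedAddCommGroup A] [NormedSpace ℂ A]

/-- Cauchy estimate: differentiating along `T` preserves the order of vanishing along `y = 0`. -/
theorem isBigO_fderiv_inl {h : T × Y → A} {k : ℕ}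
    (hd : ∀ᶠ p in 𝓝 (0 : T × Y), DifferentiableAt ℂ h p)
    (hO : h =O[𝓝 0] fun p => ‖p.2‖ ^ k) (v : T) :
    (fun p => fderiv ℂ h p (v, 0)) =O[𝓝 0] fun p => ‖p.2‖ ^ k := by
  obtain ⟨K, hK⟩ := hO.bound
  obtain ⟨ε, hε, hball⟩ := Metric.eventually_nhds_iff_ball.1 (hd.and hK)
  obtain ⟨r, hr, hrv⟩ : ∃ r : ℝ, 0 < r ∧ r * ‖v‖ < ε / 2 := by
    refine ⟨ε / 2 / (‖v‖ + 1), by positivity, ?_⟩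
    have : 0 < ‖v‖ + 1 := by positivity
    rw [div_mul_eq_mul_div, div_lt_iff₀ this]
    nlinarith
  refine IsBigO.of_bound (K / r) ?_
  filter_upwards [Metric.ball_mem_nhds (0 : T × Y) (half_pos hε)] with p hp
  have hmem : ∀ s ∈ Metric.closedBall (0 : ℂ) r, p + s • ((v, 0) : T × Y) ∈ Metric.ball 0 ε := by
    intro s hs
    rw [mem_ball_zero_iff] at hp ⊢
    rw [mem_closedBall_zero_iff] at hs
    have h1 : ‖s • ((v, 0) : T × Y)‖ ≤ r * ‖v‖ := by
      rw [norm_smul, Prod.norm_mk, norm_zero, max_eq_left (norm_nonneg v)]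
      gcongr
    linarith [norm_add_le p (s • ((v, 0) : T × Y))]
  have hline : ∀ s ∈ Metric.closedBall (0 : ℂ) r,
      HasDerivAt (fun s : ℂ => h (p + s • ((v, 0) : T × Y)))
        (fderiv ℂ h (p + s • ((v, 0) : T × Y)) (v, 0)) s := by
    intro s hs
    have h1 : HasDerivAt (fun s : ℂ => p + s • ((v, 0) : T × Y)) ((v, 0) : T × Y) s := by
      simpa using ((hasDerivAt_id s).smul_const ((v, 0) : T × Y)).const_add p
    exact (hball _ (hmem s hs)).1.hasFDerivAt.comp_hasDerivAt s h1
  have hcl : DiffContOnCl ℂ (fun s : ℂ => h (p + s • ((v, 0) : T × Y))) (Metric.ball 0 r) := by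
    apply DifferentiableOn.diffContOnCl
    rw [closure_ball _ hr.ne']
    exact fun s hs => (hline s hs).differentiableAt.differentiableWithinAt
  have hbd : ∀ s ∈ Metric.sphere (0 : ℂ) r,
      ‖h (p + s • ((v, 0) : T × Y))‖ ≤ K * ‖p.2‖ ^ k := by
    intro s hs
    have := (hball _ (hmem s (Metric.sphere_subset_closedBall hs))).2
    simpa using this
  have := Complex.norm_deriv_le_of_forall_mem_sphere_norm_le hr hcl hbd
  rw [(hline 0 (Metric.mem_closedBall_self hr.le)).deriv] at this
  simp only [zero_smul, add_zero] at this
  rw [norm_pow, norm_norm, div_mul_eq_mul_div]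
  exact this

/-- Integrating along `Y` raises the order of vanishing along `y = 0` by one. -/
theorem isBigO_pow_succ_of_fderiv_inr {l k : ℕ} {h : T × (Fin l → ℂ) → A}
    (hd : ∀ᶠ p in 𝓝 (0 : T × (Fin l → ℂ)), DifferentiableAt ℂ h p)
    (h0 : ∀ᶠ p in 𝓝 (0 : T × (Fin l → ℂ)), p.2 = 0 → h p = 0)
    (hO : ∀ α, (fun p => fderiv ℂ h p (0, Pi.single α 1)) =O[𝓝 0] fun p => ‖p.2‖ ^ k) :
    h =O[𝓝 0] fun p => ‖p.2‖ ^ (k + 1) := by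
  choose K hK0 hK using fun α => (hO α).exists_nonneg
  obtain ⟨ε, hε, hball⟩ := Metric.eventually_nhds_iff_ball.1
    ((hd.and h0).and (eventually_all.2 fun α => (hK α).bound))
  refine IsBigO.of_bound (∑ α, K α) ?_
  filter_upwards [Metric.ball_mem_nhds 0 hε] with p hp
  rw [mem_ball_zero_iff] at hp
  have hmem : ∀ y ∈ Metric.closedBall (0 : Fin l → ℂ) ‖p.2‖,
      ((p.1, y) : T × (Fin l → ℂ)) ∈ Metric.ball 0 ε := by
    intro y hy
    rw [mem_closedBall_zero_iff] at hy
    rw [mem_ball_zero_iff]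
    exact lt_of_le_of_lt (max_le_max le_rfl hy) hp
  have hder : ∀ y ∈ Metric.closedBall (0 : Fin l → ℂ) ‖p.2‖,
      HasFDerivWithinAt (fun y => h (p.1, y))
        ((fderiv ℂ h (p.1, y)).comp (ContinuousLinearMap.inr ℂ T (Fin l → ℂ)))
        (Metric.closedBall (0 : Fin l → ℂ) ‖p.2‖) y := by
    intro y hy
    exact ((hball _ (hmem y hy)).1.1.hasFDerivAt.comp y
      (hasFDerivAt_prodMk_right p.1 y)).hasFDerivWithinAt
  have hle : ∀ y ∈ Metric.closedBall (0 : Fin l → ℂ) ‖p.2‖, ∀ α,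
      ‖fderiv ℂ h (p.1, y) (0, Pi.single α 1)‖ ≤ K α * ‖p.2‖ ^ k := by
    intro y hy α
    have hyp : ‖y‖ ≤ ‖p.2‖ := mem_closedBall_zero_iff.1 hy
    refine ((hball _ (hmem y hy)).2 α).trans ?_
    rw [norm_pow, norm_norm]
    exact mul_le_mul_of_nonneg_left (pow_le_pow_left₀ (norm_nonneg _) hyp k) (hK0 α)
  have hbd : ∀ y ∈ Metric.closedBall (0 : Fin l → ℂ) ‖p.2‖,
      ‖(fderiv ℂ h (p.1, y)).comp (ContinuousLinearMap.inr ℂ T (Fin l → ℂ))‖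
        ≤ (∑ α, K α) * ‖p.2‖ ^ k := by
    intro y hy
    have hK' : 0 ≤ ∑ α, K α := Finset.sum_nonneg fun α _ => hK0 α
    refine ContinuousLinearMap.opNorm_le_bound _ (by positivity) fun w => ?_
    have hw : ((0, w) : T × (Fin l → ℂ)) = ∑ α, w α • ((0, Pi.single α 1) : T × (Fin l → ℂ)) := by
      refine Prod.ext (by simp [Prod.fst_sum]) ?_
      simp only [Prod.snd_sum, Prod.smul_mk]
      exact pi_eq_sum_univ' w
    rw [ContinuousLinearMap.comp_apply, ContinuousLinearMap.inr_apply, hw, map_sum,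
      Finset.sum_mul, Finset.sum_mul]
    refine norm_sum_le_of_le _ fun α _ => ?_
    rw [map_smul, norm_smul, mul_comm]
    exact mul_le_mul (hle y hy α) (norm_le_pi_norm w α) (norm_nonneg _)
      (mul_nonneg (hK0 α) (by positivity))
  have := (convex_closedBall (0 : Fin l → ℂ) ‖p.2‖).norm_image_sub_le_of_norm_hasFDerivWithin_le
    hder hbd (Metric.mem_closedBall_self (norm_nonneg _)) (y := p.2) (by simp)
  rw [(hball _ (hmem 0 (Metric.mem_closedBall_self (norm_nonneg _)))).1.2 rfl, sub_zero,
    sub_zero] at this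
  rw [norm_pow, norm_norm, pow_succ, ← mul_assoc]
  exact this

/-- A holomorphic function vanishing to infinite order along `y = 0` at the origin vanishes
near the origin. -/
theorem eventually_eq_zero_of_isBigO_pow [CompleteSpace A] {h : T × Y → A}
    (hd : ∀ᶠ p in 𝓝 (0 : T × Y), DifferentiableAt ℂ h p)
    (hO : ∀ k : ℕ, h =O[𝓝 0] fun p => ‖p.2‖ ^ k) :
    ∀ᶠ p in 𝓝 (0 : T × Y), h p = 0 := by
  obtain ⟨ε, hε, hball⟩ := Metric.eventually_nhds_iff_ball.1 hd
  filter_upwards [Metric.ball_mem_nhds 0 (half_pos hε)] with p hp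
  rw [mem_ball_zero_iff] at hp
  set g : ℂ → A := fun s => h (s • p) with hg
  have hgd : DifferentiableOn ℂ g (Metric.ball 0 2) := by
    intro s hs
    rw [mem_ball_zero_iff] at hs
    have : s • p ∈ Metric.ball (0 : T × Y) ε := by
      rw [mem_ball_zero_iff, norm_smul]
      nlinarith [norm_nonneg s, norm_nonneg p]
    exact ((hball _ this).comp s (by fun_prop)).differentiableWithinAt
  have hga : AnalyticOnNhd ℂ g (Metric.ball 0 2) := hgd.analyticOnNhd Metric.isOpen_ball
  have hg0 := hga 0 (Metric.mem_ball_self two_pos)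
  have hgO : ∀ k : ℕ, g =O[𝓝 0] fun s => s ^ k := by
    intro k
    have ht : Tendsto (fun s : ℂ => s • p) (𝓝 0) (𝓝 0) := by
      have : ContinuousAt (fun s : ℂ => s • p) 0 := by fun_prop
      simpa [ContinuousAt] using this
    refine ((hO k).comp_tendsto ht).trans (IsBigO.of_bound (‖p.2‖ ^ k) (Eventually.of_forall ?_))
    intro s
    simp [norm_smul, mul_pow, mul_comm]
  have hz : ∀ᶠ s in 𝓝 (0 : ℂ), g s = 0 := by
    by_contra hne
    obtain ⟨k, q, hq, hq0, hqe⟩ := (hg0.exists_eventuallyEq_pow_smul_nonzero_iff).2 hne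
    have h1 : (fun s : ℂ => s ^ k • q s) =O[𝓝 0] fun s => s ^ (k + 1) :=
      (hgO (k + 1)).congr' (hqe.mono fun s hs => by simpa using hs) EventuallyEq.rfl
    obtain ⟨K, hK⟩ := h1.bound
    have h2 : ∀ᶠ s in 𝓝[≠] (0 : ℂ), ‖q s‖ ≤ K * ‖s‖ := by
      filter_upwards [hK.filter_mono nhdsWithin_le_nhds, self_mem_nhdsWithin] with s hs hs0
      have hs1 : 0 < ‖s‖ ^ k := pow_pos (norm_pos_iff.2 hs0) k
      rw [norm_smul, norm_pow, norm_pow, pow_succ] at hs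
      refine le_of_mul_le_mul_left (hs.trans_eq ?_) hs1
      ring
    have h3 : Tendsto (fun s => ‖q s‖) (𝓝[≠] 0) (𝓝 ‖q 0‖) :=
      hq.continuousAt.norm.tendsto.mono_left nhdsWithin_le_nhds
    have h4 : Tendsto (fun s : ℂ => K * ‖s‖) (𝓝[≠] 0) (𝓝 0) := by
      have : ContinuousAt (fun s : ℂ => K * ‖s‖) 0 := by fun_prop
      simpa using this.tendsto.mono_left nhdsWithin_le_nhds
    exact hq0 (norm_le_zero_iff.1 (le_of_tendsto_of_tendsto h3 h4 h2))
  have := hga.eqOn_zero_of_preconnected_of_eventuallyEq_zero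
    (convex_ball (0 : ℂ) 2).isPreconnected (Metric.mem_ball_self two_pos) hz
    (show (1 : ℂ) ∈ Metric.ball 0 2 by simp)
  simpa [hg] using this

end VanishingAlongASubspace
section NoncommutativePolynomials

variable {ι R : Type*}

theorem Commute.freeAlgebra_lift [Ring R] [Algebra ℂ R] {b : ι → R} {x : R}
    (hx : ∀ i, Commute x (b i)) (a : FreeAlgebra ℂ ι) : Commute x (FreeAlgebra.lift ℂ b a) := by
  induction a using FreeAlgebra.induction with
  | grade0 c => simpa using Algebra.commute_algebraMap_right c x
  | grade1 i => simpa using hx i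
  | mul a a' ha ha' => simpa using ha.mul_right ha'
  | add a a' ha ha' => simpa using ha.add_right ha'

variable {E : Type*} [NormedRing R]

theorem ContinuousAt.freeAlgebra_lift [NormedAlgebra ℂ R] [TopologicalSpace E] {b : ι → E → R} {p : E}
    (hb : ∀ i, ContinuousAt (b i) p) (a : FreeAlgebra ℂ ι) :
    ContinuousAt (fun q => FreeAlgebra.lift ℂ (fun i => b i q) a) p := by
  induction a using FreeAlgebra.induction with
  | grade0 c => simpa using continuousAt_const
  | grade1 i => simpa using hb i
  | mul a a' ha ha' =>
    simp only [map_mul]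
    exact ha.mul ha'
  | add a a' ha ha' =>
    simp only [map_add]
    exact ha.add ha'

theorem isBigO_mul_sub_mul [TopologicalSpace E] {p : E} {x y x' y' : E → R} {g : E → ℝ}
    (hy : ContinuousAt y p) (hx' : ContinuousAt x' p)
    (hx : (fun q => x q - x' q) =O[𝓝 p] g) (hyy : (fun q => y q - y' q) =O[𝓝 p] g) :
    (fun q => x q * y q - x' q * y' q) =O[𝓝 p] g := by
  have h1 := hx.mul (hy.norm.isBoundedUnder_le.isBigO_one ℝ)
  have h2 := (hx'.norm.isBoundedUnder_le.isBigO_one ℝ).mul hyy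
  simp only [mul_one, one_mul] at h1 h2
  exact (h1.add h2).congr_left fun q => by noncomm_ring

theorem isBigO_freeAlgebra_lift_sub [NormedAlgebra ℂ R] [TopologicalSpace E] {p : E}
    {b b' : ι → E → R} {g : E → ℝ}
    (hb : ∀ i, ContinuousAt (b i) p) (hb' : ∀ i, ContinuousAt (b' i) p)
    (h : ∀ i, (fun q => b i q - b' i q) =O[𝓝 p] g) (a : FreeAlgebra ℂ ι) :
    (fun q => FreeAlgebra.lift ℂ (fun i => b i q) a -
      FreeAlgebra.lift ℂ (fun i => b' i q) a) =O[𝓝 p] g := by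
  induction a using FreeAlgebra.induction with
  | grade0 c => simpa using isBigO_zero g (𝓝 p)
  | grade1 i => simpa using h i
  | mul a a' ha ha' =>
    simpa using isBigO_mul_sub_mul (ContinuousAt.freeAlgebra_lift hb a')
      (ContinuousAt.freeAlgebra_lift hb' a) ha ha'
  | add a a' ha ha' =>
    simp only [map_add]
    exact (ha.add ha').congr_left fun q => by abel

theorem isBigO_of_mul_right [CompleteSpace R] [TopologicalSpace E] {p : E} {x M : E → R}
    {g : E → ℝ} (hM : ContinuousAt M p) (hp : IsUnit (M p))
    (h : (fun q => x q * M q) =O[𝓝 p] g) : x =O[𝓝 p] g := by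
  obtain ⟨u, hu⟩ := hp
  have hinv : ContinuousAt (fun q => Ring.inverse (M q)) p :=
    ContinuousAt.comp (g := Ring.inverse) (hu ▸ NormedRing.inverse_continuousAt u) hM
  have hunit : ∀ᶠ q in 𝓝 p, IsUnit (M q) :=
    hM.eventually (Units.isOpen.mem_nhds (show IsUnit (M p) from ⟨u, hu⟩))
  have h1 := h.mul (hinv.norm.isBoundedUnder_le.isBigO_one ℝ)
  simp only [mul_one] at h1
  refine h1.congr' ?_ EventuallyEq.rfl
  filter_upwards [hunit] with q hq
  rw [mul_assoc, Ring.mul_inverse_cancel _ hq, mul_one]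

end NoncommutativePolynomials

theorem GenCond.exists_freeAlgebra_lift {n r : ℕ} {B : Fin r → Mat n} {ζ : Fin n → ℂ}
    (h : GenCond B ζ) (v : Fin n → ℂ) :
    ∃ a : FreeAlgebra ℂ (Fin r), (FreeAlgebra.lift ℂ B a).mulVec ζ = v := by
  have hv : v ∈ (⊤ : Submodule ℂ (Fin n → ℂ)) := trivial
  rw [← h] at hv
  induction hv using Submodule.span_induction with
  | mem x hx =>
    obtain ⟨L, rfl⟩ := hx
    refine ⟨(L.map (FreeAlgebra.ι ℂ)).prod, ?_⟩
    rw [map_list_prod, List.map_map]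
    congr 3
    funext i
    simp
  | zero => exact ⟨0, by simp⟩
  | add x y _ _ hx hy =>
    obtain ⟨a, rfl⟩ := hx
    obtain ⟨a', rfl⟩ := hy
    exact ⟨a + a', by rw [map_add, Matrix.add_mulVec]⟩
  | smul c x _ hx =>
    obtain ⟨a, rfl⟩ := hx
    exact ⟨c • a, by rw [map_smul, Matrix.smul_mulVec]⟩

section MatrixNorm

attribute [local instance] Matrix.linftyOpNormedRing Matrix.linftyOpNormedAlgebra

/-- Matrices commuting with a generating family are controlled by that family and by the column
on which it generates. -/
theorem isBigO_sub_of_commute {E : Type*} [TopologicalSpace E] {p : E} {n r : ℕ} {j₀ : Fin n}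
    {B B' : Fin r → E → Mat n} {F F' : E → Mat n} {g : E → ℝ}
    (hB : ∀ i, ContinuousAt (B i) p) (hB' : ∀ i, ContinuousAt (B' i) p)
    (hF' : ContinuousAt F' p)
    (hc : ∀ᶠ q in 𝓝 p, ∀ i, Commute (F q) (B i q))
    (hc' : ∀ᶠ q in 𝓝 p, ∀ i, Commute (F' q) (B' i q))
    (hcol : ∀ᶠ q in 𝓝 p, ∀ i, F q i j₀ = F' q i j₀)
    (hgen : GenCond (fun i => B i p) (Pi.single j₀ 1))
    (hO : ∀ i, (fun q => B i q - B' i q) =O[𝓝 p] g) :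
    (fun q => F q - F' q) =O[𝓝 p] g := by
  have : CompleteSpace (Mat n) := FiniteDimensional.complete ℂ _
  choose a ha using fun j => hgen.exists_freeAlgebra_lift (Pi.single j 1)
  set S : Fin n → E → Mat n := fun j q => FreeAlgebra.lift ℂ (fun i => B i q) (a j) with hS
  set S' : Fin n → E → Mat n := fun j q => FreeAlgebra.lift ℂ (fun i => B' i q) (a j) with hS'
  have hSc : ∀ j, ContinuousAt (S j) p := fun j => ContinuousAt.freeAlgebra_lift hB (a j)
  have hSO : ∀ j, (fun q => S j q - S' j q) =O[𝓝 p] g := fun j =>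
    isBigO_freeAlgebra_lift_sub hB hB' hO (a j)
  set M : E → Mat n := fun q => ∑ j, S j q * Matrix.single j₀ j 1 with hM
  have hMc : ContinuousAt M p :=
    tendsto_finsetSum (M := Mat n) _ fun j _ => (hSc j).mul continuousAt_const
  have hMp : M p = 1 := by
    ext i k
    have h1 := congrFun (ha k) i
    simp only [Matrix.mulVec_single_one, Matrix.col_apply] at h1
    simp only [hM, Matrix.sum_apply, Matrix.mul_apply, Matrix.single_apply, mul_ite, mul_one,
      mul_zero]
    rw [Finset.sum_eq_single k, Finset.sum_eq_single j₀]
    · simpa [hS, Matrix.one_apply, Pi.single_apply] using h1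
    · intro b _ hb
      simp [hb.symm]
    · simp
    · intro b _ hb
      simp [hb]
    · simp
  refine isBigO_of_mul_right hMc (hMp ▸ isUnit_one) ?_
  have hterm : ∀ j, (fun q => ((S j q - S' j q) * F' q - F' q * (S j q - S' j q)) *
      Matrix.single j₀ j 1) =O[𝓝 p] g := by
    intro j
    have h1 := (hSO j).mul (hF'.norm.isBoundedUnder_le.isBigO_one ℝ)
    have h2 := (hF'.norm.isBoundedUnder_le.isBigO_one ℝ).mul (hSO j)
    have h3 : (fun _ : E => (Matrix.single j₀ j 1 : Mat n)) =O[𝓝 p] fun _ => (1 : ℝ) :=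
      isBigO_const_const _ one_ne_zero _
    simp only [mul_one, one_mul] at h1 h2
    simpa using (h1.sub h2).mul h3
  refine (IsBigO.sum (s := Finset.univ) fun j _ => hterm j).congr' ?_ EventuallyEq.rfl
  filter_upwards [hc, hc', hcol] with q hq hq' hcq
  simp only [hM, Finset.mul_sum, Finset.sum_apply]
  refine Finset.sum_congr rfl fun j _ => ?_
  have h1 : F q * S j q = S j q * F q := Commute.freeAlgebra_lift hq (a j)
  have h2 : F' q * S' j q = S' j q * F' q := Commute.freeAlgebra_lift hq' (a j)
  have h3 : F q * Matrix.single j₀ j 1 = F' q * Matrix.single j₀ j 1 := by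
    ext i k
    simp [Matrix.mul_apply, Matrix.single_apply, hcq, ite_and]
  have h4 : S j q * F q * Matrix.single j₀ j 1 = S j q * F' q * Matrix.single j₀ j 1 := by
    rw [mul_assoc, h3, mul_assoc]
  calc _ = S j q * F' q * Matrix.single j₀ j 1 - S' j q * F' q * Matrix.single j₀ j 1
        - F' q * S j q * Matrix.single j₀ j 1 + F' q * S' j q * Matrix.single j₀ j 1 := by
        noncomm_ring
    _ = F q * S j q * Matrix.single j₀ j 1 - F' q * S j q * Matrix.single j₀ j 1 := by
        rw [← h4, h1, h2]; abel
    _ = _ := by noncomm_ring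

variable {E : Type*} [NormedAddCommGroup E] [NormedSpace ℂ E] {n : ℕ}

theorem MDiffOn.differentiableAt {f : E → Mat n} {s : Set E} {p : E} (hf : MDiffOn f s)
    (hs : s ∈ 𝓝 p) : DifferentiableAt ℂ f p := by
  have h1 : f = fun q => ∑ k, ∑ j, f q k j • Matrix.single k j (1 : ℂ) := by
    funext q
    conv_lhs => rw [Matrix.matrix_eq_sum_single (f q)]
    simp [Matrix.smul_single]
  rw [h1]
  exact DifferentiableAt.fun_sum fun k _ => DifferentiableAt.fun_sum fun j _ =>
    ((hf k j).differentiableAt hs).smul_const _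

theorem mpderiv_eq_fderiv {f : E → Mat n} {p : E} (hf : DifferentiableAt ℂ f p) (v : E) :
    mpderiv f p v = fderiv ℂ f p v := by
  ext k j
  let e : Mat n →L[ℂ] ℂ := LinearMap.toContinuousLinearMap (Matrix.entryLinearMap ℂ ℂ k j)
  have := (e.hasFDerivAt.comp p hf.hasFDerivAt).fderiv
  have h2 : (fun q => f q k j) = e ∘ f := rfl
  rw [mpderiv, Matrix.of_apply, h2, this]
  rfl

theorem isBigO_matComm_sub {X : Type*} [TopologicalSpace X] {p : X} {A B A' B' : X → Mat n}
    {g : X → ℝ} (hA : ContinuousAt A p) (hB : ContinuousAt B p) (hA' : ContinuousAt A' p)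
    (hB' : ContinuousAt B' p) (hAA : (fun q => A q - A' q) =O[𝓝 p] g)
    (hBB : (fun q => B q - B' q) =O[𝓝 p] g) :
    (fun q => matComm (A q) (B q) - matComm (A' q) (B' q)) =O[𝓝 p] g :=
  ((isBigO_mul_sub_mul hB hA' hAA hBB).sub (isBigO_mul_sub_mul hA hB' hBB hAA)).congr_left
    fun q => by simp only [matComm]; abel

/-- If two holomorphic maps agree on `y = 0` and their `y`-derivatives agree to order `k`, then the
maps agree to order `k + 1`. -/
theorem isBigO_sub_of_mpderiv {m l k : ℕ} {G G' : Pt m l → Mat n}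
    (hG : ∀ᶠ p in 𝓝 0, DifferentiableAt ℂ G p) (hG' : ∀ᶠ p in 𝓝 0, DifferentiableAt ℂ G' p)
    (h0 : ∀ᶠ p in 𝓝 (0 : Pt m l), p.2 = 0 → G p = G' p)
    (hO : ∀ α, (fun p => mpderiv G p (0, Pi.single α 1) - mpderiv G' p (0, Pi.single α 1))
      =O[𝓝 0] fun p => ‖p.2‖ ^ k) :
    (fun p => G p - G' p) =O[𝓝 0] fun p => ‖p.2‖ ^ (k + 1) := by
  refine isBigO_pow_succ_of_fderiv_inr ?_ ?_ fun α => (hO α).congr' ?_ EventuallyEq.rfl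
  · filter_upwards [hG, hG'] with p h h' using h.sub h'
  · filter_upwards [h0] with p h hp using sub_eq_zero.2 (h hp)
  · filter_upwards [hG, hG'] with p h h'
    rw [mpderiv_eq_fderiv h, mpderiv_eq_fderiv h', fderiv_fun_sub h h']
    rfl

theorem isBigO_mpderiv_inl_sub {m l k : ℕ} {G G' : Pt m l → Mat n}
    (hG : ∀ᶠ p in 𝓝 0, DifferentiableAt ℂ G p) (hG' : ∀ᶠ p in 𝓝 0, DifferentiableAt ℂ G' p)
    (hO : (fun p => G p - G' p) =O[𝓝 0] fun p => ‖p.2‖ ^ k) (v : Fin m → ℂ) :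
    (fun p => mpderiv G p (v, 0) - mpderiv G' p (v, 0)) =O[𝓝 0] fun p => ‖p.2‖ ^ k := by
  refine (isBigO_fderiv_inl ?_ hO v).congr' ?_ EventuallyEq.rfl
  · filter_upwards [hG, hG'] with p h h' using h.sub h'
  · filter_upwards [hG, hG'] with p h h'
    rw [mpderiv_eq_fderiv h, mpderiv_eq_fderiv h', fderiv_fun_sub h h']
    rfl

theorem MDiffOn.eventually_differentiableAt {f : E → Mat n} {s : Set E} {p : E}
    (hf : MDiffOn f s) (hs : IsOpen s) (hp : p ∈ s) : ∀ᶠ q in 𝓝 p, DifferentiableAt ℂ f q := by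
  filter_upwards [hs.mem_nhds hp] with q hq using hf.differentiableAt (hs.mem_nhds hq)

section Solutions

variable {m l : ℕ} {hn : 0 < n} {C₀ : Fin m → (Fin m → ℂ) → Mat n}
  {U₀ V₀ W₀ : (Fin m → ℂ) → Mat n} {f : Fin n → Pt m l → ℂ} {N N₁ N₂ : Set (Pt m l)}
  {C C' : Fin m → Pt m l → Mat n} {F F' : Fin l → Pt m l → Mat n}
  {U V W U' V' W' : Pt m l → Mat n}

theorem IsSolution.eventually_commute (hs : IsSolution hn C₀ U₀ V₀ W₀ f N C F U V W)
    (hN : IsOpen N) (h0 : (0 : Pt m l) ∈ N) (α : Fin l) :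
    ∀ᶠ p in 𝓝 0, ∀ i : Fin (m + 1),
      Commute (F α p) ((Fin.snoc (fun i => C i p) (U p) : Fin (m + 1) → Mat n) i) := by
  filter_upwards [hN.mem_nhds h0] with p hp i
  obtain ⟨-, -, -, -, -, -, -, hfull⟩ := hs
  obtain ⟨-, hCF, -, -, -, -, -, hFU, -⟩ := hfull p hp
  induction i using Fin.lastCases with
  | last => simpa [matComm, sub_eq_zero, commute_iff_eq] using hFU α
  | cast i =>
    have := hCF i α
    rw [matComm, sub_eq_zero] at this
    simpa [commute_iff_eq] using this.symm

theorem IsSolution.continuousAt_snoc (hs : IsSolution hn C₀ U₀ V₀ W₀ f N C F U V W)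
    (hN : IsOpen N) (h0 : (0 : Pt m l) ∈ N) (i : Fin (m + 1)) :
    ContinuousAt (fun p => (Fin.snoc (fun i => C i p) (U p) : Fin (m + 1) → Mat n) i) 0 := by
  obtain ⟨hC, -, hU, -⟩ := hs
  induction i using Fin.lastCases with
  | last => simpa using (hU.differentiableAt (hN.mem_nhds h0)).continuousAt
  | cast i => simpa using ((hC i).differentiableAt (hN.mem_nhds h0)).continuousAt

theorem IsSolution.isBigO_sub_F (hs : IsSolution hn C₀ U₀ V₀ W₀ f N₁ C F U V W)
    (hs' : IsSolution hn C₀ U₀ V₀ W₀ f N₂ C' F' U' V' W')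
    (hN₁ : IsOpen N₁) (hN₂ : IsOpen N₂) (h0₁ : (0 : Pt m l) ∈ N₁) (h0₂ : (0 : Pt m l) ∈ N₂)
    (hGC : GenCond (Fin.snoc (fun i => C₀ i 0) (U₀ 0)) (Pi.single (⟨0, hn⟩ : Fin n) 1))
    {g : Pt m l → ℝ} (hC : ∀ i, (fun p => C i p - C' i p) =O[𝓝 0] g)
    (hU : (fun p => U p - U' p) =O[𝓝 0] g) (α : Fin l) :
    (fun p => F α p - F' α p) =O[𝓝 0] g := by
  refine isBigO_sub_of_commute (j₀ := ⟨0, hn⟩) (hs.continuousAt_snoc hN₁ h0₁)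
    (hs'.continuousAt_snoc hN₂ h0₂) ((hs'.2.1 α).differentiableAt (hN₂.mem_nhds h0₂)).continuousAt
    (hs.eventually_commute hN₁ h0₁ α) (hs'.eventually_commute hN₂ h0₂ α) ?_ ?_ ?_
  · obtain ⟨-, -, -, -, -, -, hcol, -⟩ := hs
    obtain ⟨-, -, -, -, -, -, hcol', -⟩ := hs'
    filter_upwards [hN₁.mem_nhds h0₁, hN₂.mem_nhds h0₂] with p h1 h2 i
    rw [hcol p h1, hcol' p h2]
  · obtain ⟨-, -, -, -, -, hr, -, -⟩ := hs
    obtain ⟨hC0, hU0, -⟩ := hr 0 h0₁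
    have h1 : ∀ i, C i 0 = C₀ i 0 := hC0
    have h2 : U 0 = U₀ 0 := hU0
    simpa only [h1, h2] using hGC
  · intro i
    induction i using Fin.lastCases with
    | last => simpa using hU
    | cast i => simpa using hC i

theorem IsSolution.isBigO_sub (hs : IsSolution hn C₀ U₀ V₀ W₀ f N₁ C F U V W)
    (hs' : IsSolution hn C₀ U₀ V₀ W₀ f N₂ C' F' U' V' W')
    (hN₁ : IsOpen N₁) (hN₂ : IsOpen N₂) (h0₁ : (0 : Pt m l) ∈ N₁) (h0₂ : (0 : Pt m l) ∈ N₂)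
    (hGC : GenCond (Fin.snoc (fun i => C₀ i 0) (U₀ 0)) (Pi.single (⟨0, hn⟩ : Fin n) 1))
    (k : ℕ) :
    (∀ i, (fun p => C i p - C' i p) =O[𝓝 0] fun p => ‖p.2‖ ^ k) ∧
    (fun p => U p - U' p) =O[𝓝 0] (fun p => ‖p.2‖ ^ k) ∧
    (fun p => V p - V' p) =O[𝓝 0] (fun p => ‖p.2‖ ^ k) ∧
    (fun p => W p - W' p) =O[𝓝 0] (fun p => ‖p.2‖ ^ k) := by
  have key := fun k : ℕ =>
    hs.isBigO_sub_F hs' hN₁ hN₂ h0₁ h0₂ hGC (g := fun p => ‖p.2‖ ^ k)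
  obtain ⟨hC, hF, hU, hV, hW, hr, -, hfull⟩ := hs
  obtain ⟨hC', hF', hU', hV', hW', hr', -, hfull'⟩ := hs'
  have dC := fun i => (hC i).eventually_differentiableAt hN₁ h0₁
  have dC' := fun i => (hC' i).eventually_differentiableAt hN₂ h0₂
  have dF := fun i => (hF i).eventually_differentiableAt hN₁ h0₁
  have dF' := fun i => (hF' i).eventually_differentiableAt hN₂ h0₂
  have dU := hU.eventually_differentiableAt hN₁ h0₁
  have dU' := hU'.eventually_differentiableAt hN₂ h0₂
  have dV := hV.eventually_differentiableAt hN₁ h0₁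
  have dV' := hV'.eventually_differentiableAt hN₂ h0₂
  have dW := hW.eventually_differentiableAt hN₁ h0₁
  have dW' := hW'.eventually_differentiableAt hN₂ h0₂
  have cF := fun i => (dF i).self_of_nhds.continuousAt
  have cF' := fun i => (dF' i).self_of_nhds.continuousAt
  have cV := dV.self_of_nhds.continuousAt
  have cV' := dV'.self_of_nhds.continuousAt
  have cW := dW.self_of_nhds.continuousAt
  have cW' := dW'.self_of_nhds.continuousAt
  have hmem : ∀ᶠ p in 𝓝 (0 : Pt m l), p ∈ N₁ ∧ p ∈ N₂ :=
    (hN₁.eventually_mem h0₁).and (hN₂.eventually_mem h0₂)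
  have hrestr : ∀ᶠ p in 𝓝 (0 : Pt m l), p.2 = 0 →
      (∀ i, C i p = C' i p) ∧ U p = U' p ∧ V p = V' p ∧ W p = W' p := by
    filter_upwards [hmem] with p hp hp2
    obtain ⟨t, y⟩ := p
    obtain rfl : y = 0 := hp2
    obtain ⟨h1, h2, h3, h4⟩ := hr t hp.1
    obtain ⟨h1', h2', h3', h4'⟩ := hr' t hp.2
    exact ⟨fun i => (h1 i).trans (h1' i).symm, h2.trans h2'.symm, h3.trans h3'.symm,
      h4.trans h4'.symm⟩
  induction k with
  | zero =>
    have hone : ∀ {G G' : Pt m l → Mat n}, ContinuousAt G 0 → ContinuousAt G' 0 →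
        (fun p => G p - G' p) =O[𝓝 0] fun p => ‖p.2‖ ^ 0 := fun h h' => by
      simpa using (h.sub h').norm.isBoundedUnder_le.isBigO_one ℝ
    exact ⟨fun i => hone (dC i).self_of_nhds.continuousAt (dC' i).self_of_nhds.continuousAt,
      hone dU.self_of_nhds.continuousAt dU'.self_of_nhds.continuousAt, hone cV cV', hone cW cW'⟩
  | succ k ih =>
    obtain ⟨iC, iU, iV, iW⟩ := ih
    have iF := key k iC iU
    have hVF := fun α => isBigO_matComm_sub cV (cF α) cV' (cF' α) iV (iF α)
    have hWF := fun α => isBigO_matComm_sub cW (cF α) cW' (cF' α) iW (iF α)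
    refine ⟨fun i => isBigO_sub_of_mpderiv (dC i) (dC' i) (hrestr.mono fun p h hp => (h hp).1 i)
        fun α => (isBigO_mpderiv_inl_sub (dF α) (dF' α) (iF α) (Pi.single i 1)).congr' ?_
          EventuallyEq.rfl,
      isBigO_sub_of_mpderiv dU dU' (hrestr.mono fun p h hp => (h hp).2.1)
        fun α => ((hVF α).sub (iF α)).congr' ?_ EventuallyEq.rfl,
      isBigO_sub_of_mpderiv dV dV' (hrestr.mono fun p h hp => (h hp).2.2.1)
        fun α => (hWF α).neg_left.congr' ?_ EventuallyEq.rfl,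
      isBigO_sub_of_mpderiv dW dW' (hrestr.mono fun p h hp => (h hp).2.2.2)
        fun α => (hWF α).congr' ?_ EventuallyEq.rfl⟩ <;>
    filter_upwards [hmem] with p hp <;>
    obtain ⟨-, -, -, -, eC, -, -, -, -, eU, -, eW, -, eV⟩ := hfull p hp.1 <;>
    obtain ⟨-, -, -, -, eC', -, -, -, -, eU', -, eW', -, eV'⟩ := hfull' p hp.2
    · rw [eC, eC']
    · rw [eU, eU']; abel
    · rw [eV, eV']; abel
    · rw [eW, eW']

theorem IsSolution.eventually_eq (hs : IsSolution hn C₀ U₀ V₀ W₀ f N₁ C F U V W)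
    (hs' : IsSolution hn C₀ U₀ V₀ W₀ f N₂ C' F' U' V' W')
    (hN₁ : IsOpen N₁) (hN₂ : IsOpen N₂) (h0₁ : (0 : Pt m l) ∈ N₁) (h0₂ : (0 : Pt m l) ∈ N₂)
    (hGC : GenCond (Fin.snoc (fun i => C₀ i 0) (U₀ 0)) (Pi.single (⟨0, hn⟩ : Fin n) 1)) :
    ∀ᶠ p in 𝓝 (0 : Pt m l), (∀ i, C i p = C' i p) ∧ (∀ α, F α p = F' α p) ∧
      U p = U' p ∧ V p = V' p ∧ W p = W' p := by
  have : CompleteSpace (Mat n) := FiniteDimensional.complete ℂ _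
  have hO := hs.isBigO_sub hs' hN₁ hN₂ h0₁ h0₂ hGC
  have hOF := fun k α => hs.isBigO_sub_F hs' hN₁ hN₂ h0₁ h0₂ hGC (hO k).1 (hO k).2.1 α
  have heq : ∀ {G G' : Pt m l → Mat n}, MDiffOn G N₁ → MDiffOn G' N₂ →
      (∀ k : ℕ, (fun p => G p - G' p) =O[𝓝 0] fun p => ‖p.2‖ ^ k) →
      ∀ᶠ p in 𝓝 0, G p = G' p := fun hG hG' h => by
    refine (eventually_eq_zero_of_isBigO_pow ?_ h).mono fun p hp => sub_eq_zero.1 hp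
    filter_upwards [hG.eventually_differentiableAt hN₁ h0₁,
      hG'.eventually_differentiableAt hN₂ h0₂] with p h h' using h.sub h'
  obtain ⟨hC, hF, hU, hV, hW, -⟩ := hs
  obtain ⟨hC', hF', hU', hV', hW', -⟩ := hs'
  filter_upwards [eventually_all.2 fun i => heq (hC i) (hC' i) fun k => (hO k).1 i,
    eventually_all.2 fun α => heq (hF α) (hF' α) fun k => hOF k α,
    heq hU hU' fun k => (hO k).2.1, heq hV hV' fun k => (hO k).2.2.1,
    heq hW hW' fun k => (hO k).2.2.2] with p h1 h2 h3 h4 h5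
  exact ⟨h1, h2, h3, h4, h5⟩

end Solutions

end MatrixNorm

theorem stmt_1
    (n m l : ℕ) (hn : 0 < n) (hl : 0 < l)
    (N₀ : Set (Fin m → ℂ)) (hN₀open : IsOpen N₀) (hN₀0 : (0 : Fin m → ℂ) ∈ N₀)
    (C₀ : Fin m → (Fin m → ℂ) → Mat n)
    (U₀ V₀ W₀ : (Fin m → ℂ) → Mat n)
    (hC₀d : ∀ i, MDiffOn (C₀ i) N₀)
    (hU₀d : MDiffOn U₀ N₀) (hV₀d : MDiffOn V₀ N₀) (hW₀d : MDiffOn W₀ N₀)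
    (h1 : ∀ t ∈ N₀, ∀ i j, matComm (C₀ i t) (C₀ j t) = 0)
    (h2 : ∀ t ∈ N₀, ∀ i j,
      mpderiv (C₀ i) t (Pi.single j 1) = mpderiv (C₀ j) t (Pi.single i 1))
    (h3 : ∀ t ∈ N₀, ∀ i, matComm (C₀ i t) (U₀ t) = 0)
    (h4 : ∀ t ∈ N₀, ∀ i,
      mpderiv U₀ t (Pi.single i 1) = matComm (V₀ t) (C₀ i t) - C₀ i t)
    (h5 : ∀ t ∈ N₀, ∀ i, mpderiv W₀ t (Pi.single i 1) = matComm (W₀ t) (C₀ i t))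
    (h6 : ∀ t ∈ N₀, ∀ i, mpderiv V₀ t (Pi.single i 1) = - matComm (W₀ t) (C₀ i t))
    (hGC : GenCond (Fin.snoc (fun i => C₀ i 0) (U₀ 0))
      (Pi.single (⟨0, hn⟩ : Fin n) 1))
    (f : Fin n → Pt m l → ℂ)
    (Nf : Set (Pt m l)) (hNfopen : IsOpen Nf) (hNf0 : (0 : Pt m l) ∈ Nf)
    (hfd : ∀ i, DifferentiableOn ℂ (f i) Nf)
    (hf0 : ∀ (i) (t : Fin m → ℂ), ((t, 0) : Pt m l) ∈ Nf → f i (t, 0) = 0)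
    -- the two solutions
    (N₁ N₂ : Set (Pt m l)) (hN₁ : IsOpen N₁) (hN₂ : IsOpen N₂)
    (h0₁ : (0 : Pt m l) ∈ N₁) (h0₂ : (0 : Pt m l) ∈ N₂)
    (C : Fin m → Pt m l → Mat n) (F : Fin l → Pt m l → Mat n)
    (U V W : Pt m l → Mat n)
    (C' : Fin m → Pt m l → Mat n) (F' : Fin l → Pt m l → Mat n)
    (U' V' W' : Pt m l → Mat n)
    (hsol : IsSolution hn C₀ U₀ V₀ W₀ f N₁ C F U V W)
    (hsol' : IsSolution hn C₀ U₀ V₀ W₀ f N₂ C' F' U' V' W') :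
    ∃ N : Set (Pt m l), IsOpen N ∧ (0 : Pt m l) ∈ N ∧ N ⊆ N₁ ∩ N₂ ∧
      ∀ p ∈ N, (∀ i, C i p = C' i p) ∧ (∀ α, F α p = F' α p) ∧
        U p = U' p ∧ V p = V' p ∧ W p = W' p := by
  obtain ⟨N, hN, hNopen, hN0⟩ := eventually_nhds_iff.1
    (((hN₁.eventually_mem h0₁).and (hN₂.eventually_mem h0₂)).and
      (hsol.eventually_eq hsol' hN₁ hN₂ h0₁ h0₂ hGC))
  exact ⟨N, hNopen, hN0, fun p hp => (hN p hp).1, fun p hp => (hN p hp).2⟩
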